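/- arXiv:2510.05550 — 3 statements merged into one kernel-verified Lean document; each statement's English description precedes it below -/
import Mathlib

section
/- Let G be a nonempty c-path bounded subset of D. Strong connectedness (mutual reachability by paths in G) is an equivalence relation on G; if this equivalence relation has only finitely many equivalence classes (i.e., the condensation graph of G has finitely many strongly connected components), then G has a c-antiderivative. -/
open scoped BigOperators

namespace Paper

variable {X Y : Type*}

/-- The domain of the cost `c`, i.e. the set where `c` is finite. -/
def Dom (c : X × Y → EReal) : Set (X × Y) := {p | c p < ⊤}

/-- `z` is a path in `G` from `p` to `q` (with `N` steps). -/
def IsPath (c : X × Y → EReal) (G : Set (X × Y)) (p q : X × Y)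
    (N : ℕ) (z : Fin (N + 1) → X × Y) : Prop :=
  (∀ k, z k ∈ G) ∧ z 0 = p ∧ z (Fin.last N) = q ∧
    ∀ k : Fin N, c ((z k.succ).1, (z k.castSucc).2) < ⊤

/-- The inner variation `∑_{k=1}^N (c(x_k,y_k) − c(x_{k+1},y_k))` along a path; all the
terms involved are finite for a path in `G ⊆ Dom c`, so the real-valued sum is faithful. -/
noncomputable def pathSum (c : X × Y → EReal) {N : ℕ} (z : Fin (N + 1) → X × Y) : ℝ :=
  ∑ k : Fin N, ((c (z k.castSucc)).toReal - (c ((z k.succ).1, (z k.castSucc).2)).toReal)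

/-- The maximal inner variation `F_G(p,q)`, with the convention `sSup ∅ = ⊥ = −∞`. -/
noncomputable def innerVar (c : X × Y → EReal) (G : Set (X × Y)) (p q : X × Y) : EReal :=
  sSup {s : EReal | ∃ (N : ℕ) (z : Fin (N + 1) → X × Y),
    IsPath c G p q N z ∧ s = ((pathSum c z : ℝ) : EReal)}

/-- `G` is `c`-path bounded. -/
def PathBounded (c : X × Y → EReal) (G : Set (X × Y)) : Prop :=
  ∀ p ∈ G, ∀ q ∈ G, innerVar c G p q < ⊤

/-- `G` is `c`-cyclically monotone. -/
def CyclicallyMonotone (c : X × Y → EReal) (G : Set (X × Y)) : Prop :=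
  ∀ p ∈ G, innerVar c G p p ≤ 0

/-- `f` is a `c`-antiderivative of `G`:
`c(x,y) − c(u,y) ≤ f(x,y) − f(u,v)` in `[−∞,+∞]` for all `(x,y),(u,v) ∈ G`. -/
def IsAntideriv (c : X × Y → EReal) (G : Set (X × Y)) (f : X × Y → ℝ) : Prop :=
  ∀ p ∈ G, ∀ q ∈ G, c p - c (q.1, p.2) ≤ (f p : EReal) - (f q : EReal)

/-- `p` and `q` are strongly connected (mutually reachable by paths) in `G`. -/
def StronglyConn (c : X × Y → EReal) (G : Set (X × Y)) (p q : X × Y) : Prop :=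
  (∃ N z, IsPath c G p q N z) ∧ (∃ N z, IsPath c G q p N z)

/-- Prepending a point of `G` to a path. -/
theorem IsPath.cons {c : X × Y → EReal} {G : Set (X × Y)} {p q r : X × Y} {N : ℕ}
    {z : Fin (N + 1) → X × Y} (hz : IsPath c G q r N z) (hp : p ∈ G)
    (hpq : c (q.1, p.2) < ⊤) :
    IsPath c G p r (N + 1) (Fin.cons p z : Fin (N + 2) → X × Y) := by
  obtain ⟨hG, h0, hl, hc⟩ := hz
  refine ⟨fun k => ?_, rfl, ?_, fun k => ?_⟩
  · cases k using Fin.cases with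
    | zero => exact hp
    | succ k => exact hG k
  · rw [← Fin.succ_last, Fin.cons_succ, hl]
  · cases k using Fin.cases with
    | zero => simpa [h0] using hpq
    | succ k =>
      rw [← Fin.succ_castSucc, Fin.cons_succ, Fin.cons_succ]
      exact hc k

theorem pathSum_cons (c : X × Y → EReal) {N : ℕ} (p : X × Y) (z : Fin (N + 1) → X × Y) :
    pathSum c (Fin.cons p z : Fin (N + 2) → X × Y) =
      ((c p).toReal - (c ((z 0).1, p.2)).toReal) + pathSum c z := by
  unfold pathSum
  rw [Fin.sum_univ_succ]
  simp only [← Fin.succ_castSucc, Fin.cons_succ, Fin.castSucc_zero, Fin.cons_zero]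

/-- The constant path. -/
theorem IsPath.refl (c : X × Y → EReal) {G : Set (X × Y)} {p : X × Y} (hp : p ∈ G) :
    IsPath c G p p 0 fun _ => p :=
  ⟨fun _ => hp, rfl, rfl, fun k => k.elim0⟩

theorem IsPath.exists_trans {c : X × Y → EReal} {G : Set (X × Y)} {p q r : X × Y} {N : ℕ}
    {z : Fin (N + 1) → X × Y} (hz : IsPath c G p q N z) (hqr : ∃ M w, IsPath c G q r M w) :
    ∃ M w, IsPath c G p r M w := by
  induction N generalizing p with
  | zero =>
    obtain ⟨-, rfl, rfl, -⟩ := hz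
    exact hqr
  | succ N ih =>
    obtain ⟨hG, rfl, hl, hc⟩ := hz
    obtain ⟨M, w, hw⟩ := ih (p := z (Fin.succ 0)) (z := fun k => z k.succ)
      ⟨fun k => hG _, rfl, by simpa using hl, fun k => hc k.succ⟩
    exact ⟨M + 1, _, hw.cons (hG 0) (hc 0)⟩

theorem StronglyConn.equivalence (c : X × Y → EReal) (G : Set (X × Y)) :
    Equivalence (fun p q : G => StronglyConn c G p.1 q.1) where
  refl p := ⟨⟨_, _, .refl c p.2⟩, ⟨_, _, .refl c p.2⟩⟩
  symm h := ⟨h.2, h.1⟩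
  trans := by
    rintro p q r ⟨⟨_, _, hpq⟩, hqp⟩ ⟨hqr, ⟨_, _, hrq⟩⟩
    exact ⟨hpq.exists_trans hqr, hrq.exists_trans hqp⟩

/-- The inner variations of all paths in `G` from `p` to a point of `R`. -/
def pathSums (c : X × Y → EReal) (G R : Set (X × Y)) (p : X × Y) : Set ℝ :=
  {s | ∃ r ∈ R, ∃ (N : ℕ) (z : Fin (N + 1) → X × Y), IsPath c G p r N z ∧ s = pathSum c z}

theorem PathBounded.bddAbove_pathSums {c : X × Y → EReal} {G R : Set (X × Y)}
    (hpb : PathBounded c G) (hR : R.Finite) (hRG : R ⊆ G) {p : X × Y} (hp : p ∈ G) :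
    BddAbove (pathSums c G R p) := by
  have hunion : pathSums c G R p = ⋃ r ∈ R, {s | ∃ (N : ℕ) (z : Fin (N + 1) → X × Y),
      IsPath c G p r N z ∧ s = pathSum c z} := by
    ext s
    simp [pathSums]
  rw [hunion, hR.bddAbove_biUnion]
  intro r hr
  refine ⟨(innerVar c G p r).toReal, ?_⟩
  rintro _ ⟨N, z, hz, rfl⟩
  have hle : ((pathSum c z : ℝ) : EReal) ≤ innerVar c G p r := le_sSup ⟨N, z, hz, rfl⟩
  exact_mod_cast hle.trans (EReal.le_coe_toReal (hpb p hp r (hRG hr)).ne)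

/-- If a finite `R ⊆ G` can be reached from every point of `G`, then the largest inner variation
of a path ending in `R` is an antiderivative. -/
theorem PathBounded.isAntideriv_sSup_pathSums {c : X × Y → EReal} {G R : Set (X × Y)}
    (hpb : PathBounded c G) (hbot : ∀ p, c p ≠ ⊥) (hGD : G ⊆ Dom c)
    (hR : R.Finite) (hRG : R ⊆ G) (hreach : ∀ p ∈ G, ∃ r ∈ R, ∃ N z, IsPath c G p r N z) :
    IsAntideriv c G fun p => sSup (pathSums c G R p) := by
  intro p hp q hq
  have hcp : c p ≠ ⊤ := (hGD hp).ne
  by_cases htop : c (q.1, p.2) = ⊤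
  · simp [htop]
  rw [← EReal.coe_toReal hcp (hbot p), ← EReal.coe_toReal htop (hbot _)]
  norm_cast
  suffices h : sSup (pathSums c G R q) ≤
      sSup (pathSums c G R p) - ((c p).toReal - (c (q.1, p.2)).toReal) by linarith
  refine csSup_le ?_ ?_
  · obtain ⟨r, hr, N, z, hz⟩ := hreach q hq
    exact ⟨_, r, hr, N, z, hz, rfl⟩
  · rintro _ ⟨r, hr, N, z, hz, rfl⟩
    have hle := le_csSup (hpb.bddAbove_pathSums hR hRG hp)
      ⟨r, hr, N + 1, _, hz.cons hp (lt_top_iff_ne_top.2 htop), rfl⟩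
    rw [pathSum_cons, hz.2.1] at hle
    linarith

/-- strong connectedness is an equivalence relation on `G`, and if there are
only finitely many strongly connected components then `G` has a `c`-antiderivative. -/
theorem antideriv_of_finitely_many_components (c : X × Y → EReal) (hbot : ∀ p, c p ≠ ⊥)
    (G : Set (X × Y)) (hne : G.Nonempty) (hGD : G ⊆ Dom c)
    (hpb : PathBounded c G) :
    Equivalence (fun p q : G => StronglyConn c G p.1 q.1) ∧
      ({C : Set (X × Y) | ∃ p ∈ G, C = {q ∈ G | StronglyConn c G p q}}.Finite →
        ∃ f : X × Y → ℝ, IsAntideriv c G f) := by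
  refine ⟨StronglyConn.equivalence c G, fun hfin => ?_⟩
  have himage : {C : Set (X × Y) | ∃ p ∈ G, C = {q ∈ G | StronglyConn c G p q}} =
      (fun p => {q ∈ G | StronglyConn c G p q}) '' G := by
    ext C
    simp [eq_comm]
  rw [himage] at hfin
  obtain ⟨R, hRG, hbij⟩ :=
    Set.exists_subset_bijOn G (fun p => {q ∈ G | StronglyConn c G p q})
  have hR : R.Finite := Set.Finite.of_finite_image (hbij.image_eq.symm ▸ hfin) hbij.injOn
  refine ⟨_, hpb.isAntideriv_sSup_pathSums hbot hGD hR hRG fun p hp => ?_⟩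
  obtain ⟨r, hr, hrp⟩ := hbij.surjOn (Set.mem_image_of_mem _ hp)
  have hmem : r ∈ {q ∈ G | StronglyConn c G p q} := by
    rw [← hrp]
    exact ⟨hRG hr, (StronglyConn.equivalence c G).refl ⟨r, hRG hr⟩⟩
  exact ⟨r, hr, hmem.2.1⟩

end Paper
end

section
/- Let X = Y = ℝⁿ and let c be the Coulomb cost, c(x,y) = 1/‖x − y‖ if x ≠ y and c(x,y) = +∞ if x = y, so that D = {(x,y) ∈ ℝⁿ × ℝⁿ : x ≠ y}. Then every nonempty c-path bounded subset G of D has a c-antiderivative. -/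
open scoped BigOperators

namespace Paper

variable {X Y : Type*}

open Classical in
/-- The Coulomb cost on `ℝⁿ × ℝⁿ`. -/
noncomputable def coulomb (n : ℕ)
    (p : EuclideanSpace ℝ (Fin n) × EuclideanSpace ℝ (Fin n)) : EReal :=
  if p.1 = p.2 then ⊤ else ((1 / ‖p.1 - p.2‖ : ℝ) : EReal)

section General

variable {c : X × Y → EReal} {G : Set (X × Y)}

theorem isPath_const {p : X × Y} (hp : p ∈ G) : IsPath c G p p 0 fun _ => p :=
  ⟨fun _ => hp, rfl, rfl, fun k => k.elim0⟩

theorem IsPath.snoc {p q r : X × Y} {N : ℕ} {z : Fin (N + 1) → X × Y}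
    (hz : IsPath c G p q N z) (hr : r ∈ G) (hqr : c (r.1, q.2) < ⊤) :
    IsPath c G p r (N + 1) (Fin.snoc (α := fun _ => X × Y) z r) := by
  obtain ⟨hG, h0, hl, hs⟩ := hz
  refine ⟨fun k => ?_, ?_, ?_, fun k => ?_⟩
  · refine Fin.lastCases ?_ (fun i => ?_) k
    · simpa using hr
    · simpa using hG i
  · rw [← Fin.castSucc_zero, Fin.snoc_castSucc, h0]
  · simp
  · refine Fin.lastCases ?_ (fun i => ?_) k
    · rw [Fin.succ_last, Fin.snoc_last, Fin.snoc_castSucc, hl]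
      exact hqr
    · rw [Fin.succ_castSucc, Fin.snoc_castSucc, Fin.snoc_castSucc]
      exact hs i

theorem pathSum_snoc {N : ℕ} (z : Fin (N + 1) → X × Y) (r : X × Y) :
    pathSum c (Fin.snoc (α := fun _ => X × Y) z r) = pathSum c z +
      ((c (z (Fin.last N))).toReal - (c (r.1, (z (Fin.last N)).2)).toReal) := by
  unfold pathSum
  rw [Fin.sum_univ_castSucc]
  simp only [Fin.succ_castSucc, Fin.snoc_castSucc, Fin.succ_last, Fin.snoc_last]

theorem IsPath.le_innerVar {p q : X × Y} {N : ℕ} {z : Fin (N + 1) → X × Y}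
    (hz : IsPath c G p q N z) : ((pathSum c z : ℝ) : EReal) ≤ innerVar c G p q :=
  le_sSup ⟨N, z, hz, rfl⟩

theorem innerVar_ne_bot {p q : X × Y} (h : ∃ N z, IsPath c G p q N z) :
    innerVar c G p q ≠ ⊥ := by
  obtain ⟨N, z, hz⟩ := h
  exact ((EReal.bot_lt_coe _).trans_le hz.le_innerVar).ne'

/-- A path bounded set all of whose points are reachable from a single one has an
antiderivative. -/
theorem PathBounded.exists_isAntideriv (hbot : ∀ p, c p ≠ ⊥) (hGD : G ⊆ Dom c)
    (hpb : PathBounded c G) {o : X × Y} (ho : o ∈ G)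
    (hreach : ∀ q ∈ G, ∃ N z, IsPath c G o q N z) :
    ∃ f : X × Y → ℝ, IsAntideriv c G f := by
  refine ⟨fun p => -(innerVar c G o p).toReal, fun p hp q hq => ?_⟩
  have coe_innerVar : ∀ r ∈ G, ((innerVar c G o r).toReal : EReal) = innerVar c G o r :=
    fun r hr => EReal.coe_toReal (hpb o ho r hr).ne (innerVar_ne_bot (hreach r hr))
  by_cases hpq : c (q.1, p.2) = ⊤
  · simp [hpq]
  have key : innerVar c G o p ≤ (((innerVar c G o q).toReal -
      ((c p).toReal - (c (q.1, p.2)).toReal) : ℝ) : EReal) := by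
    refine sSup_le ?_
    rintro _ ⟨N, z, hz, rfl⟩
    have h := (hz.snoc hq (lt_top_iff_ne_top.2 hpq)).le_innerVar
    rw [← coe_innerVar q hq, pathSum_snoc, hz.2.2.1, EReal.coe_le_coe_iff] at h
    exact EReal.coe_le_coe_iff.2 (by linarith)
  rw [← coe_innerVar p hp, EReal.coe_le_coe_iff] at key
  rw [← EReal.coe_toReal (hGD hp).ne (hbot p), ← EReal.coe_toReal hpq (hbot _),
    ← EReal.coe_sub, ← EReal.coe_sub, EReal.coe_le_coe_iff]
  linarith

end General

section Coulomb

variable {n : ℕ}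

theorem coulomb_lt_top_iff {p : EuclideanSpace ℝ (Fin n) × EuclideanSpace ℝ (Fin n)} :
    coulomb n p < ⊤ ↔ p.1 ≠ p.2 := by
  unfold coulomb
  split_ifs with h
  · simp [h]
  · simp [h]

theorem coulomb_ne_bot (p : EuclideanSpace ℝ (Fin n) × EuclideanSpace ℝ (Fin n)) :
    coulomb n p ≠ ⊥ := by
  unfold coulomb
  split_ifs
  · simp
  · exact EReal.coe_ne_bot _

/-- If `q` is not reachable from `p`, then every point of `G` has `p.2 = q.1` as one of its
coordinates. -/
theorem eq_of_not_reachable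
    {G : Set (EuclideanSpace ℝ (Fin n) × EuclideanSpace ℝ (Fin n))}
    {p q : EuclideanSpace ℝ (Fin n) × EuclideanSpace ℝ (Fin n)} (hp : p ∈ G) (hq : q ∈ G)
    (h : ¬ ∃ N z, IsPath (coulomb n) G p q N z) :
    q.1 = p.2 ∧ ∀ r ∈ G, r.1 = p.2 ∨ r.2 = p.2 := by
  have hqp : q.1 = p.2 := by
    by_contra hne
    exact h ⟨_, _, (isPath_const hp).snoc hq (coulomb_lt_top_iff.2 hne)⟩
  refine ⟨hqp, fun r hr => ?_⟩
  by_contra! hne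
  exact h ⟨_, _, ((isPath_const hp).snoc hr (coulomb_lt_top_iff.2 hne.1)).snoc hq
    (coulomb_lt_top_iff.2 (hqp.trans_ne hne.2.symm))⟩

end Coulomb

/-- for the Coulomb cost on `ℝⁿ`, every nonempty `c`-path bounded subset
of the domain `D = {(x,y) | x ≠ y}` has a `c`-antiderivative. -/
theorem coulomb_antideriv_of_pathBounded (n : ℕ)
    (G : Set (EuclideanSpace ℝ (Fin n) × EuclideanSpace ℝ (Fin n)))
    (hne : G.Nonempty) (hGD : G ⊆ Dom (coulomb n))
    (hpb : PathBounded (coulomb n) G) :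
    ∃ f : EuclideanSpace ℝ (Fin n) × EuclideanSpace ℝ (Fin n) → ℝ,
      IsAntideriv (coulomb n) G f := by
  by_cases hroot : ∃ o ∈ G, ∀ q ∈ G, ∃ N z, IsPath (coulomb n) G o q N z
  · obtain ⟨o, ho, hreach⟩ := hroot
    exact hpb.exists_isAntideriv coulomb_ne_bot hGD ho hreach
  -- Otherwise `G` consists of at most two points `(b, y)` and `(y, b)`.
  push Not at hroot
  obtain ⟨p, hp⟩ := hne
  obtain ⟨q, hq, hpq⟩ := hroot p hp
  obtain ⟨r, hr, hqr⟩ := hroot q hq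
  obtain ⟨hqp, hb⟩ := eq_of_not_reachable hp hq (by simpa using hpq)
  obtain ⟨-, hy⟩ := eq_of_not_reachable hq hr (by simpa using hqr)
  have hD : ∀ s ∈ G, s.1 ≠ s.2 := fun s hs => coulomb_lt_top_iff.1 (hGD hs)
  refine ⟨fun _ => 0, fun s hs t ht => ?_⟩
  by_cases hst : t.1 = s.2
  · have htop : coulomb n (t.1, s.2) = ⊤ := by simp [coulomb, hst]
    simp [htop]
  · have heq : t = s := by
      have := hD s hs
      have := hD t ht
      have := hD q hq
      have := hb s hs
      have := hb t ht
      have := hy s hs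
      have := hy t ht
      ext1 <;> grind
    subst heq
    simp [EReal.sub_self (hGD ht).ne (coulomb_ne_bot t)]

end Paper
end

section
/- Suppose X and Y are separable metric spaces, the domain D of c is open in X × Y, and the restriction of c to D is a continuous real-valued function. Let G be a nonempty subset of D. Then G has a continuous c-antiderivative if and only if G is c-path bounded. -/
open scoped BigOperators

namespace Paper

variable {X Y : Type*}

/-- The ℓ²-product distance `√(d_X(x,u)² + d_Y(y,v)²)` on `X × Y`. -/
noncomputable def dist2 [PseudoMetricSpace X] [PseudoMetricSpace Y] (p q : X × Y) : ℝ :=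
  Real.sqrt (dist p.1 q.1 ^ 2 + dist p.2 q.2 ^ 2)

/-- The open ball for the ℓ²-product distance. -/
def ball2 [PseudoMetricSpace X] [PseudoMetricSpace Y] (p : X × Y) (r : ℝ) : Set (X × Y) :=
  {q | dist2 p q < r}

/-- The maximal open ball centered at `p` contained in `Dom c`, i.e. `B_{ρ(p)}(p)` where
`ρ(p) = sup {r > 0 | B_r(p) ⊆ Dom c}`; note `dist2 p q < ρ(p)` iff there exists `r > 0`
with `B_r(p) ⊆ Dom c` and `dist2 p q < r`. -/
def MaxBall [PseudoMetricSpace X] [PseudoMetricSpace Y]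
    (c : X × Y → EReal) (p : X × Y) : Set (X × Y) :=
  {q | ∃ r : ℝ, 0 < r ∧ ball2 p r ⊆ Dom c ∧ dist2 p q < r}

/-- `z` is a ball chain in `G` from `p` to `q`. -/
def IsBallChain [PseudoMetricSpace X] [PseudoMetricSpace Y]
    (c : X × Y → EReal) (G : Set (X × Y)) (p q : X × Y)
    (N : ℕ) (z : Fin (N + 1) → X × Y) : Prop :=
  (∀ k, z k ∈ G) ∧ z 0 = p ∧ z (Fin.last N) = q ∧
    ∀ k : Fin N, (MaxBall c (z k.castSucc) ∩ MaxBall c (z k.succ) ∩ G).Nonempty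

/-- A countable system of potential inequalities `s ≤ f i - f j`, closed under composition and
bounded for each pair of indices, has a real-valued solution. -/
theorem exists_potential_nat (R : ℕ → ℕ → ℝ → Prop)
    (htrans : ∀ i j k s t, R i j s → R j k t → R i k (s + t))
    (hloop : ∀ i s, R i i s → s ≤ 0)
    (hbdd : ∀ i j, BddAbove {s | R i j s}) :
    ∃ f : ℕ → ℝ, ∀ i j s, R i j s → s ≤ f i - f j := by
  have step : ∀ n (g : {g : ℕ → ℝ // ∀ i < n, ∀ j < n, ∀ s, R i j s → s ≤ g i - g j}),
      ∃ g' : {g : ℕ → ℝ // ∀ i < n + 1, ∀ j < n + 1, ∀ s, R i j s → s ≤ g i - g j},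
        ∀ i < n, g'.1 i = g.1 i := by
    rintro n ⟨g, hg⟩
    obtain ⟨x, hlo, hup⟩ : ∃ x : ℝ, (∀ i < n, ∀ s, R n i s → s + g i ≤ x) ∧
        ∀ i < n, ∀ s, R i n s → x ≤ g i - s := by
      choose B hB using hbdd
      by_cases hA : ∃ i < n, ∃ s, R n i s
      · let A : Set ℝ := {a | ∃ i < n, ∃ s, R n i s ∧ a = s + g i}
        have hcross : ∀ j < n, ∀ t, R j n t → ∀ a ∈ A, a ≤ g j - t := by
          rintro j hj t ht _ ⟨i, hi, s, hs, rfl⟩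
          have := hg j hj i hi _ (htrans _ _ _ _ _ ht hs)
          linarith
        have hAbdd : BddAbove A := by
          refine ⟨∑ i ∈ Finset.range n, |B n i + g i|, ?_⟩
          rintro _ ⟨i, hi, s, hs, rfl⟩
          have h1 : s ≤ B n i := hB n i hs
          have h2 := Finset.single_le_sum (f := fun i => |B n i + g i|)
            (fun i _ => abs_nonneg _) (Finset.mem_range.2 hi)
          have h3 := le_abs_self (B n i + g i)
          linarith
        obtain ⟨i, hi, s, hs⟩ := hA
        exact ⟨sSup A, fun i hi s hs => le_csSup hAbdd ⟨i, hi, s, hs, rfl⟩,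
          fun j hj t ht => csSup_le ⟨_, i, hi, s, hs, rfl⟩ (hcross j hj t ht)⟩
      · push Not at hA
        refine ⟨-∑ i ∈ Finset.range n, |g i - B i n|, fun i hi s hs => (hA i hi s hs).elim,
          fun i hi s hs => ?_⟩
        have h1 : s ≤ B i n := hB i n hs
        have h2 := Finset.single_le_sum (f := fun i => |g i - B i n|)
          (fun i _ => abs_nonneg _) (Finset.mem_range.2 hi)
        have h3 := neg_abs_le (g i - B i n)
        linarith
    refine ⟨⟨Function.update g n x, ?_⟩, fun i hi => Function.update_of_ne hi.ne _ _⟩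
    intro i hi j hj s hs
    rcases Nat.lt_succ_iff_lt_or_eq.1 hi with hi | rfl <;>
      rcases Nat.lt_succ_iff_lt_or_eq.1 hj with hj | rfl
    · rw [Function.update_of_ne hi.ne, Function.update_of_ne hj.ne]
      exact hg i hi j hj s hs
    · rw [Function.update_of_ne hi.ne, Function.update_self]
      linarith [hup i hi s hs]
    · rw [Function.update_of_ne hj.ne, Function.update_self]
      linarith [hlo j hj s hs]
    · rw [sub_self]
      exact hloop _ s hs
  choose next hnext using step
  let u : ∀ n, {g : ℕ → ℝ // ∀ i < n, ∀ j < n, ∀ s, R i j s → s ≤ g i - g j} :=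
    fun n => Nat.rec ⟨0, by simp⟩ next n
  have hu : ∀ i n, i + 1 ≤ n → (u n).1 i = (u (i + 1)).1 i := by
    intro i n hn
    induction n, hn using Nat.le_induction with
    | base => rfl
    | succ n hn ih => exact (hnext n (u n) i hn).trans ih
  refine ⟨fun i => (u (i + 1)).1 i, fun i j s hs => ?_⟩
  beta_reduce
  rw [← hu i (max i j + 1) (by omega), ← hu j (max i j + 1) (by omega)]
  exact (u (max i j + 1)).2 i (by omega) j (by omega) s hs

/-- A system of potential inequalities in which every point is linked in both directions to a
member of a countable family, closed under composition and bounded for each pair, has a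
real-valued solution. -/
theorem exists_potential {α : Type*} (R : α → α → ℝ → Prop)
    (htrans : ∀ p q r s t, R p q s → R q r t → R p r (s + t))
    (hbdd : ∀ p q, BddAbove {s | R p q s})
    (d : ℕ → α) (hd : ∀ p, ∃ n, (∃ s, R p (d n) s) ∧ ∃ s, R (d n) p s) :
    ∃ f : α → ℝ, ∀ p q s, R p q s → s ≤ f p - f q := by
  have hloop : ∀ p s, R p p s → s ≤ 0 := by
    intro p s hs
    by_contra! hpos
    obtain ⟨B, hB⟩ := hbdd p p
    have hmul : ∀ n : ℕ, R p p ((n + 1 : ℕ) * s) := by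
      intro n
      induction n with
      | zero => simpa using hs
      | succ n ih =>
        convert htrans _ _ _ _ _ ih hs using 1
        push_cast
        ring
    obtain ⟨n, hn⟩ := exists_nat_gt (B / s)
    have h1 : ((n + 1 : ℕ) : ℝ) * s ≤ B := hB (hmul n)
    rw [div_lt_iff₀ hpos] at hn
    push_cast at h1
    linarith
  obtain ⟨g, hg⟩ := exists_potential_nat (fun i j => R (d i) (d j))
    (fun _ _ _ _ _ => htrans _ _ _ _ _) (fun _ => hloop _) (fun _ _ => hbdd _ _)
  let A : α → Set ℝ := fun p => {a | ∃ n s, R p (d n) s ∧ a = s + g n}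
  have hA : ∀ p, BddAbove (A p) := by
    intro p
    obtain ⟨m, -, t, ht⟩ := hd p
    refine ⟨g m - t, ?_⟩
    rintro _ ⟨n, s, hs, rfl⟩
    have := hg m n _ (htrans _ _ _ _ _ ht hs)
    linarith
  refine ⟨fun p => sSup (A p), fun p q s hs => ?_⟩
  suffices sSup (A q) ≤ sSup (A p) - s by linarith
  obtain ⟨m, ⟨t, ht⟩, -⟩ := hd q
  refine csSup_le ⟨_, m, t, ht, rfl⟩ ?_
  rintro _ ⟨n, r, hr, rfl⟩
  have := le_csSup (hA p) ⟨n, s + r, htrans _ _ _ _ _ hs hr, rfl⟩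
  linarith

/-- `PathValue c G p q s` means that `s` is the inner variation of some path in `G` from `p`
to `q`. -/
inductive PathValue (c : X × Y → EReal) (G : Set (X × Y)) : X × Y → X × Y → ℝ → Prop
  | refl {p : X × Y} (hp : p ∈ G) : PathValue c G p p 0
  | cons {p q r : X × Y} {s : ℝ} (hp : p ∈ G) (hpq : c (q.1, p.2) < ⊤)
      (h : PathValue c G q r s) :
      PathValue c G p r ((c p).toReal - (c (q.1, p.2)).toReal + s)

theorem PathValue.trans {c : X × Y → EReal} {G : Set (X × Y)} {p q r : X × Y} {s t : ℝ}
    (h : PathValue c G p q s) (h' : PathValue c G q r t) : PathValue c G p r (s + t) := by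
  induction h with
  | refl => simpa using h'
  | cons hp hpq _ ih =>
    rw [add_assoc]
    exact (ih h').cons hp hpq

theorem PathValue.single {c : X × Y → EReal} {G : Set (X × Y)} {p q : X × Y}
    (hp : p ∈ G) (hq : q ∈ G) (hpq : c (q.1, p.2) < ⊤) :
    PathValue c G p q ((c p).toReal - (c (q.1, p.2)).toReal) := by
  simpa using (PathValue.refl hq).cons hp hpq

theorem PathValue.exists_isPath {c : X × Y → EReal} {G : Set (X × Y)} {p q : X × Y} {s : ℝ}
    (h : PathValue c G p q s) :
    ∃ (N : ℕ) (z : Fin (N + 1) → X × Y), IsPath c G p q N z ∧ s = pathSum c z := by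
  induction h with
  | @refl p hp => exact ⟨0, fun _ => p, ⟨fun _ => hp, rfl, rfl, fun k => k.elim0⟩, by simp [pathSum]⟩
  | @cons p q r s hp hpq _ ih =>
    obtain ⟨N, z, ⟨hG, h0, hl, he⟩, rfl⟩ := ih
    refine ⟨N + 1, Fin.cons p z, ⟨?_, rfl, ?_, ?_⟩, ?_⟩
    · exact Fin.cases hp hG
    · rw [← Fin.succ_last, Fin.cons_succ, hl]
    · refine Fin.cases ?_ fun k => ?_
      · simpa [h0] using hpq
      · simpa [← Fin.succ_castSucc] using he k
    · rw [pathSum, pathSum, Fin.sum_univ_succ]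
      simp [h0]

/-- The defining inequality of a `c`-antiderivative, between real numbers. -/
theorem isAntideriv_iff {c : X × Y → EReal} (hbot : ∀ p, c p ≠ ⊥) {G : Set (X × Y)}
    (hGD : G ⊆ Dom c) {f : X × Y → ℝ} :
    IsAntideriv c G f ↔ ∀ p ∈ G, ∀ q ∈ G, c (q.1, p.2) < ⊤ →
      (c p).toReal - (c (q.1, p.2)).toReal ≤ f p - f q := by
  refine forall₂_congr fun p hp => forall₂_congr fun q _ => ?_
  have hp' : c p = ((c p).toReal : EReal) := (EReal.coe_toReal (hGD hp).ne (hbot p)).symm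
  by_cases h : c (q.1, p.2) = ⊤
  · rw [h, hp']
    simp
  · have hq' := (EReal.coe_toReal h (hbot _)).symm
    simp only [lt_top_iff_ne_top, ne_eq, h, not_false_eq_true, forall_const]
    rw [hp', hq']
    norm_cast

theorem IsPath.pathSum_le {c : X × Y → EReal} (hbot : ∀ p, c p ≠ ⊥) {G : Set (X × Y)}
    (hGD : G ⊆ Dom c) {f : X × Y → ℝ} (hf : IsAntideriv c G f) {p q : X × Y} {N : ℕ}
    {z : Fin (N + 1) → X × Y} (hz : IsPath c G p q N z) : pathSum c z ≤ f p - f q := by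
  obtain ⟨hG, rfl, rfl, he⟩ := hz
  have h1 := (Fin.sum_univ_succ fun k => f (z k)).symm.trans
    (Fin.sum_univ_castSucc fun k => f (z k))
  calc pathSum c z ≤ ∑ k : Fin N, (f (z k.castSucc) - f (z k.succ)) :=
        Finset.sum_le_sum fun k _ => (isAntideriv_iff hbot hGD).1 hf _ (hG _) _ (hG _) (he k)
    _ = f (z 0) - f (z (Fin.last N)) := by
        rw [Finset.sum_sub_distrib]
        linarith

theorem IsAntideriv.continuousOn [TopologicalSpace X] [TopologicalSpace Y]
    {c : X × Y → EReal} (hbot : ∀ p, c p ≠ ⊥) (hD : IsOpen (Dom c))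
    (hcont : ContinuousOn (fun p => (c p).toReal) (Dom c)) {G : Set (X × Y)}
    (hGD : G ⊆ Dom c) {f : X × Y → ℝ} (hf : IsAntideriv c G f) : ContinuousOn f G := by
  rw [isAntideriv_iff hbot hGD] at hf
  intro p hp
  have hc : ContinuousAt (fun p => (c p).toReal) p := hcont.continuousAt (hD.mem_nhds (hGD hp))
  have hl : Filter.Tendsto (fun q : X × Y => (q.1, p.2)) (nhds p) (nhds p) :=
    Continuous.tendsto' (by fun_prop) _ _ rfl
  have hr : Filter.Tendsto (fun q : X × Y => (p.1, q.2)) (nhds p) (nhds p) :=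
    Continuous.tendsto' (by fun_prop) _ _ rfl
  have hlo : Filter.Tendsto (fun q => f p + ((c q).toReal - (c (p.1, q.2)).toReal))
      (nhds p) (nhds (f p)) := by
    simpa using (hc.tendsto.sub (hc.tendsto.comp hr)).const_add (f p)
  have hup : Filter.Tendsto (fun q => f p - ((c p).toReal - (c (q.1, p.2)).toReal))
      (nhds p) (nhds (f p)) := by
    simpa using ((hc.tendsto.comp hl).const_sub (c p).toReal).const_sub (f p)
  refine tendsto_of_tendsto_of_tendsto_of_le_of_le' (hlo.mono_left nhdsWithin_le_nhds)
    (hup.mono_left nhdsWithin_le_nhds) ?_ ?_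
  · filter_upwards [self_mem_nhdsWithin,
      nhdsWithin_le_nhds (hr.eventually (hD.mem_nhds (hGD hp)))] with q hq hd
    linarith [hf q hq p hp hd]
  · filter_upwards [self_mem_nhdsWithin,
      nhdsWithin_le_nhds (hl.eventually (hD.mem_nhds (hGD hp)))] with q hq hd
    linarith [hf p hp q hq hd]

/-- for separable metric spaces and a cost with open domain that is
continuous (real-valued) on its domain, a nonempty `G ⊆ Dom c` has a continuous
`c`-antiderivative iff `G` is `c`-path bounded. -/
theorem continuous_antideriv_iff_pathBounded [MetricSpace X] [MetricSpace Y]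
    [TopologicalSpace.SeparableSpace X] [TopologicalSpace.SeparableSpace Y]
    (c : X × Y → EReal) (hbot : ∀ p, c p ≠ ⊥) (hD : IsOpen (Dom c))
    (hcont : ContinuousOn (fun p => (c p).toReal) (Dom c))
    (G : Set (X × Y)) (hne : G.Nonempty) (hGD : G ⊆ Dom c) :
    (∃ f : X × Y → ℝ, ContinuousOn f G ∧ IsAntideriv c G f) ↔ PathBounded c G := by
  constructor
  · rintro ⟨f, -, hf⟩ p hp q hq
    refine lt_of_le_of_lt (sSup_le ?_) (EReal.coe_lt_top (f p - f q))
    rintro _ ⟨N, z, hz, rfl⟩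
    exact EReal.coe_le_coe_iff.2 (hz.pathSum_le hbot hGD hf)
  · intro hb
    have := UniformSpace.secondCountable_of_separable X
    have := UniformSpace.secondCountable_of_separable Y
    have : Nonempty G := hne.to_subtype
    obtain ⟨f, hf⟩ := exists_potential (α := G) (fun p q => PathValue c G p q)
      (fun _ _ _ _ _ => PathValue.trans)
      (fun p q => by
        refine ⟨(innerVar c G p q).toReal, fun s hs => ?_⟩
        obtain ⟨N, z, hz, rfl⟩ := hs.exists_isPath
        have hle : ((pathSum c z : ℝ) : EReal) ≤ innerVar c G p q := le_sSup ⟨N, z, hz, rfl⟩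
        exact EReal.coe_le_coe_iff.1
          (hle.trans (EReal.le_coe_toReal (hb p p.2 q q.2).ne)))
      (TopologicalSpace.denseSeq G)
      (fun p => by
        have ho : IsOpen {q : G | (q.1.1, p.1.2) ∈ Dom c ∧ (p.1.1, q.1.2) ∈ Dom c} :=
          (hD.preimage (by fun_prop)).inter (hD.preimage (by fun_prop))
        obtain ⟨_, ⟨h1, h2⟩, n, rfl⟩ := (TopologicalSpace.denseRange_denseSeq G).inter_open_nonempty
          _ ho ⟨p, hGD p.2, hGD p.2⟩
        exact ⟨n, ⟨_, .single p.2 (Subtype.mem _) h1⟩, _, .single (Subtype.mem _) p.2 h2⟩)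
    classical
    have hF : IsAntideriv c G (fun p => if h : p ∈ G then f ⟨p, h⟩ else 0) := by
      rw [isAntideriv_iff hbot hGD]
      intro p hp q hq hpq
      simpa only [hp, hq, dif_pos] using hf ⟨p, hp⟩ ⟨q, hq⟩ _ (.single hp hq hpq)
    exact ⟨_, hF.continuousOn hbot hD hcont hGD, hF⟩

end Paper
end
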